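/- arXiv:1510.02318 — 2 statements merged into one kernel-verified Lean document; each statement's English description precedes it below -/
import Mathlib

section
/- Let X and Y be random variables on finite sets with H(Y) > 0. Then g_0(X;Y) > 0 if and only if X is weakly independent of Y; equivalently, there exists a finite-valued random variable Z with X → Y → Z a Markov chain, I(X;Z) = 0 and I(Y;Z) > 0 if and only if the vectors {P_{X|Y}(·|y) : y ∈ 𝒴, P_Y(y) > 0} are linearly dependent. -/
open scoped BigOperators Classical

/-- Shannon entropy (base 2) of a distribution on a finite alphabet,
with the convention `0 * logb 2 0 = 0`. -/
noncomputable def H {α : Type*} [Fintype α] (p : α → ℝ) : ℝ :=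
  ∑ a, -(p a * Real.logb 2 (p a))

/-- `p` is a probability mass function on a finite alphabet. -/
def IsPMF {α : Type*} [Fintype α] (p : α → ℝ) : Prop :=
  (∀ a, 0 ≤ p a) ∧ ∑ a, p a = 1

/-- First marginal of a joint distribution. -/
noncomputable def fstM {α β : Type*} [Fintype α] [Fintype β] (p : α × β → ℝ) : α → ℝ :=
  fun a => ∑ b, p (a, b)

/-- Second marginal of a joint distribution. -/
noncomputable def sndM {α β : Type*} [Fintype α] [Fintype β] (p : α × β → ℝ) : β → ℝ :=
  fun b => ∑ a, p (a, b)

/-- Mutual information (base 2) of a joint distribution. -/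
noncomputable def MI {α β : Type*} [Fintype α] [Fintype β] (p : α × β → ℝ) : ℝ :=
  H (fstM p) + H (sndM p) - H p

/-- Marginal on the first two coordinates of a triple. -/
noncomputable def m12 {α β γ : Type*} [Fintype α] [Fintype β] [Fintype γ]
    (q : α × β × γ → ℝ) : α × β → ℝ := fun ab => ∑ c, q (ab.1, ab.2, c)

/-- Marginal on the first and third coordinates of a triple. -/
noncomputable def m13 {α β γ : Type*} [Fintype α] [Fintype β] [Fintype γ]
    (q : α × β × γ → ℝ) : α × γ → ℝ := fun ac => ∑ b, q (ac.1, b, ac.2)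

/-- Marginal on the last two coordinates of a triple. -/
noncomputable def m23 {α β γ : Type*} [Fintype α] [Fintype β] [Fintype γ]
    (q : α × β × γ → ℝ) : β × γ → ℝ := fun bc => ∑ a, q (a, bc.1, bc.2)

/-- `A → B → C` is a Markov chain for a joint distribution `q` on `α × β × γ`:
`A` and `C` are conditionally independent given the middle variable `B`. -/
def Markov {α β γ : Type*} [Fintype α] [Fintype β] [Fintype γ]
    (q : α × β × γ → ℝ) : Prop :=
  ∀ a b c, q (a, b, c) * (∑ a', ∑ c', q (a', b, c')) =
    (∑ c', q (a, b, c')) * (∑ a', q (a', b, c))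

/-- The set of achievable utilities `I(Y;Z)` over finite-valued `Z` with
`X → Y → Z` a Markov chain and privacy leakage `I(X;Z) ≤ ε`. -/
def PrivSet {α β : Type*} [Fintype α] [Fintype β] (ε : ℝ) (p : α × β → ℝ) : Set ℝ :=
  { r | ∃ (γ : Type) (_ : Fintype γ) (q : α × β × γ → ℝ),
      IsPMF q ∧ m12 q = p ∧ Markov q ∧ MI (m13 q) ≤ ε ∧ r = MI (m23 q) }

/-- The rate-privacy function `g_ε(X;Y)`. -/
noncomputable def g {α β : Type*} [Fintype α] [Fintype β] (ε : ℝ) (p : α × β → ℝ) : ℝ :=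
  sSup (PrivSet ε p)

/-- The conditional distribution `P_{X|Y}(·|y)` (the zero map if `P_Y(y) = 0`). -/
noncomputable def condX {α β : Type*} [Fintype α] [Fintype β] (p : α × β → ℝ) (y : β) :
    α → ℝ := fun x => p (x, y) / sndM p y

/-- `X` is weakly independent of `Y`: the family of conditional distributions
`P_{X|Y}(·|y)`, for `y` in the support of `P_Y`, is linearly dependent. -/
def WeaklyIndep {α β : Type*} [Fintype α] [Fintype β] (p : α × β → ℝ) : Prop :=
  ¬ LinearIndependent ℝ (fun y : {y : β // 0 < sndM p y} => condX p y.1)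

/-- `C_X(Y)`: the minimum of `H(W)` over finite-valued `W` with `X → W → Y` a
Markov chain and `H(W|Y) = 0`, i.e. `W = f(Y)` for a deterministic `f`. -/
noncomputable def Cmin {α β : Type*} [Fintype α] [Fintype β] (p : α × β → ℝ) : ℝ :=
  sInf { r | ∃ (γ : Type) (_ : Fintype γ) (f : β → γ),
      Markov (fun xwy : α × γ × β => if f xwy.2.2 = xwy.2.1 then p (xwy.1, xwy.2.2) else 0) ∧
      r = H (fun w : γ => ∑ y, if f y = w then sndM p y else 0) }

/-- Common entropy `G(X;Y)`: the minimum of `H(W)` over finite-valued `W`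
with `X → W → Y` a Markov chain. -/
noncomputable def Gmin {α β : Type*} [Fintype α] [Fintype β] (p : α × β → ℝ) : ℝ :=
  sInf { r | ∃ (γ : Type) (_ : Fintype γ) (q : α × γ × β → ℝ),
      IsPMF q ∧ m13 q = p ∧ Markov q ∧ r = H (fstM (m23 q)) }

/-- Entropy of the push-forward of the distribution `pY` under the map `f`. -/
noncomputable def Hpush {β S : Type*} [Fintype β] (pY : β → ℝ) (f : β → S) : ℝ :=
  letI := Classical.decEq S
  ∑ t ∈ Finset.image f Finset.univ,
    -((∑ y ∈ Finset.univ.filter fun y => f y = t, pY y) *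
      Real.logb 2 (∑ y ∈ Finset.univ.filter fun y => f y = t, pY y))

section Marginals

variable {α β γ : Type*} [Fintype α] [Fintype β] [Fintype γ]

lemma IsPMF.le_fstM {q : α × β → ℝ} (hq : IsPMF q) (a : α) (b : β) : q (a, b) ≤ fstM q a :=
  Finset.single_le_sum (f := fun b => q (a, b)) (fun _ _ => hq.1 _) (Finset.mem_univ b)

lemma IsPMF.le_sndM {q : α × β → ℝ} (hq : IsPMF q) (a : α) (b : β) : q (a, b) ≤ sndM q b :=
  Finset.single_le_sum (f := fun a => q (a, b)) (fun _ _ => hq.1 _) (Finset.mem_univ a)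

lemma IsPMF.isPMF_fstM {q : α × β → ℝ} (hq : IsPMF q) : IsPMF (fstM q) := by
  refine ⟨fun a => Finset.sum_nonneg fun b _ => hq.1 _, ?_⟩
  rw [← hq.2, Fintype.sum_prod_type]
  rfl

lemma IsPMF.isPMF_sndM {q : α × β → ℝ} (hq : IsPMF q) : IsPMF (sndM q) := by
  refine ⟨fun b => Finset.sum_nonneg fun a _ => hq.1 _, ?_⟩
  rw [← hq.2, Fintype.sum_prod_type_right]
  rfl

lemma IsPMF.isPMF_m13 {q : α × β × γ → ℝ} (hq : IsPMF q) : IsPMF (m13 q) := by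
  refine ⟨fun _ => Finset.sum_nonneg fun _ _ => hq.1 _, ?_⟩
  rw [← hq.2]
  simp only [Fintype.sum_prod_type, m13]
  exact Finset.sum_congr rfl fun _ _ => Finset.sum_comm

lemma IsPMF.isPMF_m23 {q : α × β × γ → ℝ} (hq : IsPMF q) : IsPMF (m23 q) := by
  refine ⟨fun _ => Finset.sum_nonneg fun _ _ => hq.1 _, ?_⟩
  rw [← hq.2]
  exact (Fintype.sum_prod_type_right q).symm

lemma fstM_m23 (q : α × β × γ → ℝ) : fstM (m23 q) = sndM (m12 q) :=
  funext fun _ => Finset.sum_comm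

lemma fstM_m13 (q : α × β × γ → ℝ) : fstM (m13 q) = fstM (m12 q) :=
  funext fun _ => Finset.sum_comm

lemma sndM_m23 (q : α × β × γ → ℝ) : sndM (m23 q) = sndM (m13 q) :=
  funext fun _ => Finset.sum_comm

end Marginals

section Information

variable {α β : Type*} [Fintype α] [Fintype β]

lemma H_mul_log_two (p : α → ℝ) : H p * Real.log 2 = -∑ a, p a * Real.log (p a) := by
  have h : Real.log 2 ≠ 0 := by positivity
  rw [H, Finset.sum_mul, ← Finset.sum_neg_distrib]
  refine Finset.sum_congr rfl fun a _ => ?_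
  rw [Real.logb]
  field_simp

lemma H_fstM_mul_log_two (q : α × β → ℝ) :
    H (fstM q) * Real.log 2 = -∑ ab : α × β, q ab * Real.log (fstM q ab.1) := by
  rw [H_mul_log_two, Fintype.sum_prod_type]
  simp only [← Finset.sum_mul]
  rfl

lemma H_sndM_mul_log_two (q : α × β → ℝ) :
    H (sndM q) * Real.log 2 = -∑ ab : α × β, q ab * Real.log (sndM q ab.2) := by
  rw [H_mul_log_two, Fintype.sum_prod_type_right]
  simp only [← Finset.sum_mul]
  rfl

/-- Mutual information in nats is the relative entropy of the joint distribution with respect to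
the product of its marginals. -/
lemma IsPMF.MI_mul_log_two {q : α × β → ℝ} (hq : IsPMF q) :
    MI q * Real.log 2 =
      ∑ ab : α × β, q ab * (Real.log (q ab) - Real.log (fstM q ab.1 * sndM q ab.2)) := by
  rw [MI, sub_mul, add_mul, H_fstM_mul_log_two, H_sndM_mul_log_two, H_mul_log_two,
    ← Finset.sum_neg_distrib, ← Finset.sum_neg_distrib, ← Finset.sum_neg_distrib,
    ← Finset.sum_add_distrib, ← Finset.sum_sub_distrib]
  refine Finset.sum_congr rfl fun ⟨a, b⟩ _ => ?_
  rcases (hq.1 (a, b)).eq_or_lt with h | h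
  · simp [← h]
  · rw [Real.log_mul (h.trans_le (hq.le_fstM a b)).ne' (h.trans_le (hq.le_sndM a b)).ne']
    ring

lemma sub_le_mul_log_sub_log {x y : ℝ} (hx : 0 ≤ x) (hy : 0 ≤ y) (h : y = 0 → x = 0) :
    x - y ≤ x * (Real.log x - Real.log y) ∧
      (x * (Real.log x - Real.log y) = x - y → x = y) := by
  rcases hx.eq_or_lt with rfl | hx
  · simp [hy, eq_comm]
  have hy : 0 < y := hy.lt_of_ne fun h' => hx.ne' (h h'.symm)
  have key : x * (Real.log x - Real.log y) = -(x * Real.log (y / x)) := by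
    rw [Real.log_div hy.ne' hx.ne']
    ring
  have hxy : x * (y / x - 1) = y - x := by field_simp
  rw [key]
  refine ⟨?_, fun he => ?_⟩
  · nlinarith [mul_le_mul_of_nonneg_left (Real.log_le_sub_one_of_pos (div_pos hy hx)) hx.le]
  · by_contra hne
    have h1 : y / x ≠ 1 := fun h1 => hne ((div_eq_one_iff_eq hx.ne').1 h1).symm
    nlinarith [mul_lt_mul_of_pos_left (Real.log_lt_sub_one_of_pos (div_pos hy hx) h1) hx]

lemma IsPMF.sub_le_MI_summand {q : α × β → ℝ} (hq : IsPMF q) (ab : α × β) :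
    q ab - fstM q ab.1 * sndM q ab.2 ≤
        q ab * (Real.log (q ab) - Real.log (fstM q ab.1 * sndM q ab.2)) ∧
      (q ab * (Real.log (q ab) - Real.log (fstM q ab.1 * sndM q ab.2)) =
        q ab - fstM q ab.1 * sndM q ab.2 → q ab = fstM q ab.1 * sndM q ab.2) := by
  refine sub_le_mul_log_sub_log (hq.1 _) (mul_nonneg (hq.isPMF_fstM.1 _) (hq.isPMF_sndM.1 _)) fun h => ?_
  refine le_antisymm ?_ (hq.1 _)
  rcases mul_eq_zero.1 h with h | h
  · exact h ▸ hq.le_fstM ab.1 ab.2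
  · exact h ▸ hq.le_sndM ab.1 ab.2

lemma IsPMF.sum_sub_mul_marginals {q : α × β → ℝ} (hq : IsPMF q) :
    ∑ ab : α × β, (q ab - fstM q ab.1 * sndM q ab.2) = 0 := by
  rw [Finset.sum_sub_distrib, hq.2, Fintype.sum_prod_type]
  simp only [← Finset.mul_sum, hq.isPMF_sndM.2, mul_one, hq.isPMF_fstM.2, sub_self]

lemma IsPMF.MI_nonneg {q : α × β → ℝ} (hq : IsPMF q) : 0 ≤ MI q := by
  have h2 : 0 < Real.log 2 := by positivity
  refine nonneg_of_mul_nonneg_left ?_ h2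
  rw [hq.MI_mul_log_two, ← hq.sum_sub_mul_marginals]
  exact Finset.sum_le_sum fun ab _ => (hq.sub_le_MI_summand ab).1

/-- Mutual information vanishes exactly for independent coordinates. -/
lemma IsPMF.MI_eq_zero_iff {q : α × β → ℝ} (hq : IsPMF q) :
    MI q = 0 ↔ ∀ a b, q (a, b) = fstM q a * sndM q b := by
  have h2 : Real.log 2 ≠ 0 := by positivity
  rw [← mul_left_inj' h2, zero_mul, hq.MI_mul_log_two]
  refine ⟨fun h a b => ?_, fun h => Finset.sum_eq_zero fun ⟨a, b⟩ _ => by simp [h a b]⟩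
  have key := (Finset.sum_eq_sum_iff_of_le fun ab _ => (hq.sub_le_MI_summand ab).1).1
    (hq.sum_sub_mul_marginals.trans h.symm)
  exact (hq.sub_le_MI_summand (a, b)).2 (key (a, b) (Finset.mem_univ _)).symm

lemma IsPMF.MI_le_H_fstM {q : α × β → ℝ} (hq : IsPMF q) : MI q ≤ H (fstM q) := by
  have h2 : 0 < Real.log 2 := by positivity
  suffices H (sndM q) ≤ H q by rw [MI]; linarith
  refine le_of_mul_le_mul_right ?_ h2
  rw [H_sndM_mul_log_two, H_mul_log_two]
  refine neg_le_neg (Finset.sum_le_sum fun ⟨a, b⟩ _ => ?_)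
  rcases (hq.1 (a, b)).eq_or_lt with h | h
  · simp [← h]
  · exact mul_le_mul_of_nonneg_left (Real.log_le_log h (hq.le_sndM a b)) h.le

end Information

section Privacy

variable {α β γ : Type*} [Fintype α] [Fintype β] [Fintype γ]

lemma IsPMF.condX_mul_sndM {p : α × β → ℝ} (hp : IsPMF p) (x : α) (y : β) :
    condX p y x * sndM p y = p (x, y) := by
  rcases eq_or_ne (sndM p y) 0 with h | h
  · rw [h, mul_zero]
    exact le_antisymm (hp.1 _) (h ▸ hp.le_sndM x y)
  · exact div_mul_cancel₀ _ h

lemma condX_of_sndM_eq_zero {p : α × β → ℝ} {y : β} (h : sndM p y = 0) : condX p y = 0 := by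
  funext x
  simp [condX, h]

lemma sum_condX {p : α × β → ℝ} {y : β} (h : sndM p y ≠ 0) : ∑ x, condX p y x = 1 := by
  simp only [condX, ← Finset.sum_div]
  exact div_self h

lemma IsPMF.not_weaklyIndep_iff {p : α × β → ℝ} (hp : IsPMF p) :
    ¬ WeaklyIndep p ↔ ∀ c : β → ℝ, (∀ x, ∑ y, condX p y x * c y = 0) →
      ∀ y, 0 < sndM p y → c y = 0 := by
  have hsum (c : β → ℝ) : ∑ y : {y : β // 0 < sndM p y}, c y • condX p y.1 =
      fun x => ∑ y, condX p y x * c y := by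
    funext x
    rw [Finset.sum_apply, ← Finset.sum_filter_of_ne (p := fun y => 0 < sndM p y),
      ← Finset.sum_subtype_eq_sum_filter]
    · simp [mul_comm]
    · intro y _ hy
      refine (hp.isPMF_sndM.1 y).lt_of_ne fun h => hy ?_
      rw [condX_of_sndM_eq_zero h.symm, Pi.zero_apply, zero_mul]
  rw [WeaklyIndep, not_not, Fintype.linearIndependent_iff]
  refine ⟨fun h c hc y hy => h (fun y => c y) ((hsum c).trans (funext hc)) ⟨y, hy⟩,
    fun h c hc y => ?_⟩
  let c' : β → ℝ := fun y => if hy : 0 < sndM p y then c ⟨y, hy⟩ else 0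
  have hc' (y : {y : β // 0 < sndM p y}) : c' y = c y := by simp [c', y.2]
  rw [← hc']
  refine h c' (fun x => ?_) y y.2
  rw [← congrFun (hsum c') x]
  simp only [hc', hc, Pi.zero_apply]

/-- In a Markov chain `X → Y → Z`, the joint law factors as `P_{X|Y} P_{YZ}`. -/
lemma Markov.eq_condX_mul {q : α × β × γ → ℝ} (hq : IsPMF q) (hM : Markov q)
    (x : α) (y : β) (z : γ) : q (x, y, z) = condX (m12 q) y x * m23 q (y, z) := by
  have h : q (x, y, z) * sndM (m12 q) y = m12 q (x, y) * m23 q (y, z) := hM x y z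
  rcases eq_or_ne (sndM (m12 q) y) 0 with h0 | h0
  · rw [condX_of_sndM_eq_zero h0, Pi.zero_apply, zero_mul]
    refine le_antisymm ?_ (hq.1 _)
    rw [← h0, ← fstM_m23]
    exact (Finset.single_le_sum (f := fun x => q (x, y, z)) (fun _ _ => hq.1 _)
      (Finset.mem_univ x)).trans (hq.isPMF_m23.le_fstM y z)
  · rw [condX, div_mul_eq_mul_div, ← h, mul_div_cancel_right₀ _ h0]

lemma MI_m23_eq_zero_of_not_weaklyIndep {q : α × β × γ → ℝ} (hp : IsPMF (m12 q)) (hq : IsPMF q)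
    (hM : Markov q) (hI : MI (m13 q) ≤ 0) (hW : ¬ WeaklyIndep (m12 q)) : MI (m23 q) = 0 := by
  have hind := hq.isPMF_m13.MI_eq_zero_iff.1 (hI.antisymm hq.isPMF_m13.MI_nonneg)
  rw [hq.isPMF_m23.MI_eq_zero_iff, fstM_m23, sndM_m23]
  intro y z
  rcases (hp.isPMF_sndM.1 y).eq_or_lt with h | h
  · rw [← h, zero_mul]
    refine le_antisymm ?_ (hq.isPMF_m23.1 _)
    rw [h, ← fstM_m23]
    exact hq.isPMF_m23.le_fstM y z
  refine sub_eq_zero.1 (hp.not_weaklyIndep_iff.1 hW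
    (fun y => m23 q (y, z) - sndM (m12 q) y * sndM (m13 q) z) (fun x => ?_) y h)
  simp only [mul_sub, Finset.sum_sub_distrib, ← hM.eq_condX_mul hq, ← mul_assoc,
    hp.condX_mul_sndM, ← Finset.sum_mul]
  rw [sub_eq_zero]
  refine (hind x z).trans ?_
  rw [fstM_m13]
  rfl

/-- A linear dependence among the conditional laws of `X` yields a binary `Z` that is independent
of `X` but not of `Y`. -/
lemma WeaklyIndep.exists_binary {p : α × β → ℝ} (hp : IsPMF p) (hW : WeaklyIndep p) :
    ∃ q : α × β × Bool → ℝ,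
      IsPMF q ∧ m12 q = p ∧ Markov q ∧ MI (m13 q) = 0 ∧ 0 < MI (m23 q) := by
  have hW' := not_not.2 hW
  rw [hp.not_weaklyIndep_iff] at hW'
  push Not at hW'
  obtain ⟨c, hc, y₀, hy₀, hcy₀⟩ := hW'
  let M : ℝ := ∑ y, |c y| / sndM p y
  have hMterm (y : β) : 0 ≤ |c y| / sndM p y := div_nonneg (abs_nonneg _) (hp.isPMF_sndM.1 y)
  have hM0 : 0 ≤ M := Finset.sum_nonneg fun y _ => hMterm y
  have hcM (y : β) (hy : 0 < sndM p y) : |c y / (1 + M)| ≤ sndM p y := by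
    have h1 : |c y| / sndM p y ≤ M :=
      Finset.single_le_sum (fun y _ => hMterm y) (Finset.mem_univ y)
    rw [abs_div, abs_of_pos (by linarith : 0 < 1 + M), div_le_iff₀ (by linarith)]
    rw [div_le_iff₀ hy] at h1
    nlinarith
  let s : Bool → ℝ := fun b => if b then 1 else -1
  let r : β → Bool → ℝ := fun y b => (sndM p y + s b * (c y / (1 + M))) / 2
  let q : α × β × Bool → ℝ := fun t => condX p t.2.1 t.1 * r t.2.1 t.2.2
  have hcond (x : α) (y : β) : 0 ≤ condX p y x := div_nonneg (hp.1 _) (hp.isPMF_sndM.1 y)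
  have h12 : m12 q = p := by
    funext ⟨x, y⟩
    rw [← hp.condX_mul_sndM x y]
    simp only [m12, q, r, s, Fintype.sum_bool]
    simp
    ring
  have h23 (y : β) (hy : sndM p y ≠ 0) (b : Bool) : m23 q (y, b) = r y b := by
    simp only [m23, q, ← Finset.sum_mul, sum_condX hy, one_mul]
  have h13 (x : α) (b : Bool) : m13 q (x, b) = fstM p x * (1 / 2) := by
    have : m13 q (x, b) =
        (∑ y, condX p y x * sndM p y + s b / (1 + M) * ∑ y, condX p y x * c y) / 2 := by
      rw [Finset.mul_sum, ← Finset.sum_add_distrib, Finset.sum_div]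
      refine Finset.sum_congr rfl fun y _ => ?_
      simp only [q, r]
      ring
    rw [this, hc]
    simp only [hp.condX_mul_sndM, fstM]
    ring
  have hq : IsPMF q := by
    refine ⟨fun ⟨x, y, b⟩ => ?_, ?_⟩
    · rcases (hp.isPMF_sndM.1 y).eq_or_lt with h | h
      · simp [q, condX_of_sndM_eq_zero h.symm]
      · refine mul_nonneg (hcond x y) ?_
        have := abs_le.1 (hcM y h)
        cases b <;> simp [r, s] <;> linarith
    · rw [← hp.2, ← h12]
      simp only [Fintype.sum_prod_type, m12]
  have hsnd (b : Bool) : sndM (m13 q) b = 1 / 2 := by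
    simp only [sndM, h13, ← Finset.sum_mul, hp.isPMF_fstM.2, one_mul]
  refine ⟨q, hq, h12, fun x y b => ?_, ?_, ?_⟩
  · change q (x, y, b) * sndM (m12 q) y = m12 q (x, y) * m23 q (y, b)
    rw [h12, ← hp.condX_mul_sndM x y]
    rcases eq_or_ne (sndM p y) 0 with h | h
    · simp [h]
    · rw [h23 y h]
      simp only [q]
      ring
  · rw [hq.isPMF_m13.MI_eq_zero_iff, fstM_m13, h12]
    intro x b
    rw [h13, hsnd]
  · refine hq.isPMF_m23.MI_nonneg.lt_of_ne' fun h => ?_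
    have h' := hq.isPMF_m23.MI_eq_zero_iff.1 h y₀ true
    rw [h23 y₀ hy₀.ne', fstM_m23, h12, sndM_m23, hsnd] at h'
    have h0 : c y₀ / (1 + M) = 0 := by
      simp only [r, s, if_true] at h'
      linarith
    exact hcy₀ ((div_eq_zero_iff.1 h0).resolve_right (by linarith))

lemma bddAbove_PrivSet (ε : ℝ) (p : α × β → ℝ) : BddAbove (PrivSet ε p) := by
  refine ⟨H (sndM p), ?_⟩
  rintro _ ⟨γ, _, q, hq, rfl, _, _, rfl⟩
  exact fstM_m23 q ▸ hq.isPMF_m23.MI_le_H_fstM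

end Privacy

/-- If `H(Y) > 0`, then `g₀(X;Y) > 0` iff `X` is weakly
independent of `Y`; equivalently, there is a finite-valued `Z` with
`X → Y → Z` a Markov chain, `I(X;Z) = 0` and `I(Y;Z) > 0` iff the conditional
distributions `{P_{X|Y}(·|y) : P_Y(y) > 0}` are linearly dependent. -/
theorem stmt2 {𝒳 𝒴 : Type*} [Fintype 𝒳] [Fintype 𝒴] (p : 𝒳 × 𝒴 → ℝ)
    (hp : IsPMF p) (hHY : 0 < H (sndM p)) :
    (0 < g 0 p ↔ WeaklyIndep p) ∧
    ((∃ (γ : Type) (_ : Fintype γ) (q : 𝒳 × 𝒴 × γ → ℝ),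
        IsPMF q ∧ m12 q = p ∧ Markov q ∧ MI (m13 q) = 0 ∧ 0 < MI (m23 q)) ↔
      WeaklyIndep p) := by
  refine ⟨⟨fun h => ?_, fun hW => ?_⟩, ⟨?_, fun hW => ?_⟩⟩
  · by_contra hW
    refine h.not_ge (Real.sSup_nonpos ?_)
    rintro _ ⟨γ, _, q, hq, rfl, hM, hI, rfl⟩
    exact (MI_m23_eq_zero_of_not_weaklyIndep hp hq hM hI hW).le
  · obtain ⟨q, hq, h12, hM, hI, hpos⟩ := hW.exists_binary hp
    exact hpos.trans_le (le_csSup (bddAbove_PrivSet 0 p)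
      ⟨Bool, inferInstance, q, hq, h12, hM, hI.le, rfl⟩)
  · rintro ⟨γ, _, q, hq, rfl, hM, hI, hpos⟩
    by_contra hW
    exact hpos.ne' (MI_m23_eq_zero_of_not_weaklyIndep hp hq hM hI.le hW)
  · obtain ⟨q, hq⟩ := hW.exists_binary hp
    exact ⟨Bool, inferInstance, q, hq⟩
end

section
/- For random variables (X,Y) on finite sets with joint distribution P_{XY}, C_X(Y) = H(Y) if and only if there exist no two points y₁, y₂ in the support of P_Y with y₁ ≠ y₂ and P_{X|Y}(·|y₁) = P_{X|Y}(·|y₂); i.e., C_X(Y) = H(Y) if and only if the map y ↦ P_{X|Y}(·|y) is injective on the support of P_Y. -/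
open scoped BigOperators Classical

/-- Push-forward of a weight function `P` under the map `f`. -/
noncomputable def pushW {β γ : Type*} [Fintype β] (f : β → γ) (P : β → ℝ) : γ → ℝ :=
  fun w => ∑ y, if f y = w then P y else 0

section PushForward

variable {β γ : Type*} [Fintype β] {f : β → γ} {P : β → ℝ}

theorem pushW_nonneg (hP : ∀ y, 0 ≤ P y) (w : γ) : 0 ≤ pushW f P w :=
  Finset.sum_nonneg fun y _ => by split_ifs <;> simp [hP y]

theorem pushW_le_sum (hP : ∀ y, 0 ≤ P y) (w : γ) : pushW f P w ≤ ∑ y, P y :=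
  Finset.sum_le_sum fun y _ => by split_ifs <;> simp [hP y]

theorem le_pushW (hP : ∀ y, 0 ≤ P y) (y : β) : P y ≤ pushW f P (f y) := by
  have h := Finset.single_le_sum (f := fun z => if f z = f y then P z else 0)
    (fun z _ => by split_ifs <;> simp [hP z]) (Finset.mem_univ y)
  simpa [pushW] using h

theorem lt_pushW (hP : ∀ y, 0 ≤ P y) {y z : β} (hne : z ≠ y) (hz : 0 < P z)
    (hf : f z = f y) : P y < pushW f P (f y) := by
  have h := Finset.single_lt_sum (f := fun z => if f z = f y then P z else 0) hne
    (Finset.mem_univ y) (Finset.mem_univ z) (by simpa [hf] using hz)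
    (fun z _ _ => by split_ifs <;> simp [hP z])
  simpa [pushW] using h

theorem pushW_eq_of_injOn (hP : ∀ y, 0 ≤ P y) {y : β}
    (hinj : ∀ z, 0 < P z → f z = f y → z = y) : pushW f P (f y) = P y := by
  rw [pushW, Finset.sum_eq_single y]
  · simp
  · intro z _ hne
    split_ifs with h
    · exact le_antisymm (not_lt.1 fun hz => hne (hinj z hz h)) (hP z)
    · rfl
  · simp

theorem H_pushW [Fintype γ] (f : β → γ) (P : β → ℝ) :
    H (pushW f P) = ∑ y, -(P y * Real.logb 2 (pushW f P (f y))) := by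
  have key : ∀ w, -(pushW f P w * Real.logb 2 (pushW f P w)) =
      ∑ y, if f y = w then -(P y * Real.logb 2 (pushW f P (f y))) else 0 := by
    intro w
    conv_lhs => rw [← neg_mul, pushW, ← Finset.sum_neg_distrib, Finset.sum_mul]
    refine Finset.sum_congr rfl fun y _ => ?_
    split_ifs with h
    · subst h; rw [neg_mul]; rfl
    · simp
  simp only [H, key]
  rw [Finset.sum_comm]
  simp

theorem H_pushW_nonneg [Fintype γ] (hP : IsPMF P) : 0 ≤ H (pushW f P) :=
  Finset.sum_nonneg fun w _ => neg_nonneg.2 <|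
    mul_nonpos_of_nonneg_of_nonpos (pushW_nonneg hP.1 w) <|
      Real.logb_nonpos one_lt_two (pushW_nonneg hP.1 w) (hP.2 ▸ pushW_le_sum hP.1 w)

theorem H_pushW_of_injOn [Fintype γ] (hP : ∀ y, 0 ≤ P y)
    (hinj : ∀ y z, 0 < P y → 0 < P z → f y = f z → y = z) : H (pushW f P) = H P := by
  rw [H_pushW, H]
  refine Finset.sum_congr rfl fun y _ => ?_
  rcases (hP y).eq_or_lt with h | h
  · simp [← h]
  · rw [pushW_eq_of_injOn hP fun z hz => hinj z y hz h]

theorem H_pushW_lt [Fintype γ] (hP : ∀ y, 0 ≤ P y) {y z : β} (hne : z ≠ y)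
    (hy : 0 < P y) (hz : 0 < P z) (hf : f z = f y) : H (pushW f P) < H P := by
  rw [H_pushW, H]
  refine Finset.sum_lt_sum (fun u _ => ?_) ⟨y, Finset.mem_univ y, ?_⟩
  · rcases (hP u).eq_or_lt with h | h
    · simp [← h]
    · exact neg_le_neg <| mul_le_mul_of_nonneg_left
        (Real.logb_le_logb_of_le one_lt_two h (le_pushW hP u)) h.le
  · exact neg_lt_neg <| mul_lt_mul_of_pos_left
      (Real.logb_lt_logb one_lt_two hy (lt_pushW hP hne hz hf)) hy

end PushForward

theorem IsPMF.sndM {α β : Type*} [Fintype α] [Fintype β] {p : α × β → ℝ} (hp : IsPMF p) :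
    IsPMF (sndM p) := by
  refine ⟨fun y => Finset.sum_nonneg fun x _ => hp.1 _, ?_⟩
  rw [← hp.2, Fintype.sum_prod_type_right]
  rfl

/-- `X → f(Y) → Y` is a Markov chain iff `p(x, y) P(f(Y) = f y) = P(x, f(Y) = f y) P(y)`. -/
theorem markov_map_iff {α β γ : Type*} [Fintype α] [Fintype β] [Fintype γ]
    (p : α × β → ℝ) (f : β → γ) :
    Markov (fun xwy : α × γ × β => if f xwy.2.2 = xwy.2.1 then p (xwy.1, xwy.2.2) else 0) ↔
      ∀ x y, p (x, y) * pushW f (sndM p) (f y) =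
        pushW f (fun z => p (x, z)) (f y) * sndM p y := by
  have hsum : ∀ w, ∑ x, ∑ y, (if f y = w then p (x, y) else 0) = pushW f (sndM p) w := by
    intro w
    rw [Finset.sum_comm]
    refine Finset.sum_congr rfl fun y _ => ?_
    split_ifs <;> simp [sndM]
  simp only [Markov, hsum]
  constructor
  · intro h x y
    simpa [pushW, sndM] using h x (f y) y
  · intro h x w y
    by_cases hw : f y = w
    · subst hw
      simpa [pushW, sndM] using h x y
    · simp [hw]

theorem condX_eq_iff {α β : Type*} [Fintype α] [Fintype β] {p : α × β → ℝ} {y z : β}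
    (hy : 0 < sndM p y) (hz : 0 < sndM p z) :
    condX p y = condX p z ↔ ∀ x, p (x, y) * sndM p z = p (x, z) * sndM p y := by
  simp only [funext_iff, condX, div_eq_div_iff hy.ne' hz.ne']

theorem markov_map_of_proportional {α β γ : Type*} [Fintype α] [Fintype β] [Fintype γ]
    {p : α × β → ℝ} {f : β → γ}
    (h : ∀ y z, f y = f z → ∀ x, p (x, y) * sndM p z = p (x, z) * sndM p y) :
    Markov (fun xwy : α × γ × β =>
      if f xwy.2.2 = xwy.2.1 then p (xwy.1, xwy.2.2) else 0) := by
  refine (markov_map_iff p f).2 fun x y => ?_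
  rw [pushW, pushW, Finset.mul_sum, Finset.sum_mul]
  refine Finset.sum_congr rfl fun z _ => ?_
  split_ifs with hz
  · exact h y z hz.symm x
  · simp

theorem condX_eq_of_markov_map {α β γ : Type*} [Fintype α] [Fintype β] [Fintype γ]
    {p : α × β → ℝ} (hp : IsPMF p) {f : β → γ}
    (hM : Markov (fun xwy : α × γ × β =>
      if f xwy.2.2 = xwy.2.1 then p (xwy.1, xwy.2.2) else 0))
    {y z : β} (hy : 0 < sndM p y) (hz : 0 < sndM p z) (hf : f y = f z) :
    condX p y = condX p z := by
  rw [markov_map_iff] at hM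
  have key : ∀ u, 0 < sndM p u → ∀ x,
      condX p u x = pushW f (fun v => p (x, v)) (f u) / pushW f (sndM p) (f u) := by
    intro u hu x
    rw [condX, div_eq_div_iff hu.ne' (hu.trans_le (le_pushW hp.sndM.1 u)).ne']
    exact hM x u
  funext x
  rw [key y hy, key z hz, hf]

/-- `C_X(Y) = H(Y)` iff the map `y ↦ P_{X|Y}(·|y)` is
injective on the support of `P_Y`. -/
theorem stmt14 {𝒳 𝒴 : Type*} [Fintype 𝒳] [Fintype 𝒴] (p : 𝒳 × 𝒴 → ℝ)
    (hp : IsPMF p) :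
    Cmin p = H (sndM p) ↔
      ∀ y₁ y₂, 0 < sndM p y₁ → 0 < sndM p y₂ → condX p y₁ = condX p y₂ → y₁ = y₂ := by
  have hP := hp.sndM
  let e := Fintype.equivFin 𝒴
  constructor
  · intro hC y₁ y₂ h₁ h₂ hc
    by_contra hne
    rw [condX_eq_iff h₁ h₂] at hc
    let f : 𝒴 → Fin (Fintype.card 𝒴) := fun y => e (if y = y₂ then y₁ else y)
    have hle : Cmin p ≤ H (pushW f (sndM p)) := by
      refine csInf_le ⟨0, ?_⟩ ⟨_, _, f, markov_map_of_proportional fun y z hf x => ?_, rfl⟩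
      · rintro r ⟨γ, _, f', _, rfl⟩
        exact H_pushW_nonneg hP
      · have hf' := e.injective hf
        have hcx := hc x
        split_ifs at hf' <;> subst_vars <;> first | rfl | exact hcx | exact hcx.symm
    exact absurd hC (hle.trans_lt (H_pushW_lt hP.1 hne h₂ h₁ (by simp [f]))).ne
  · intro hinj
    have hset : { r | ∃ (γ : Type) (_ : Fintype γ) (f : 𝒴 → γ),
        Markov (fun xwy : 𝒳 × γ × 𝒴 =>
          if f xwy.2.2 = xwy.2.1 then p (xwy.1, xwy.2.2) else 0) ∧
        r = H (fun w : γ => ∑ y, if f y = w then sndM p y else 0) } = {H (sndM p)} := by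
      refine Set.eq_singleton_iff_unique_mem.2
        ⟨⟨_, inferInstance, e, markov_map_of_proportional fun y z hf x => ?_, ?_⟩, ?_⟩
      · rw [e.injective hf]
      · exact (H_pushW_of_injOn hP.1 fun y z _ _ h => e.injective h).symm
      · rintro r ⟨γ, _, f, hM, rfl⟩
        exact H_pushW_of_injOn hP.1 fun y z hy hz hf =>
          hinj y z hy hz (condX_eq_of_markov_map hp hM hy hz hf)
    rw [Cmin, hset, csInf_singleton]
end
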